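/- Let G be a finite connected graph, w a vertex, T a BFS-tree of G rooted at w, and ρ = ρ_{w,T}(G). For any three vertices x,y,z such that z lies on some shortest path between x and y (i.e., z ∈ I(x,y)), if d(y,z) ≤ (w|x)_y then (w|y)_z = (w|x)_z − (w|x)_y + d(y,z) and (w|y)_z ≤ ρ + 1/2. -/

import Mathlib

open SimpleGraph

noncomputable section

namespace HypPaper

variable {V : Type*}

/-- Gromov product `(y|z)_w = (d(y,w)+d(z,w)-d(y,z))/2`. -/
def gp (G : SimpleGraph V) (y z w : V) : ℝ :=
  ((G.dist y w : ℝ) + (G.dist z w : ℝ) - (G.dist y z : ℝ)) / 2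

/-- `G` is `δ`-hyperbolic. -/
def IsDeltaHyp (G : SimpleGraph V) (δ : ℝ) : Prop :=
  ∀ w x y z : V, gp G x y w ≥ min (gp G x z w) (gp G y z w) - δ

/-- The hyperbolicity `δ(G)`: least `δ ≥ 0` such that `G` is `δ`-hyperbolic. -/
def hyperbolicity (G : SimpleGraph V) : ℝ :=
  sInf {δ : ℝ | 0 ≤ δ ∧ IsDeltaHyp G δ}

/-- Pointed hyperbolicity `δ_w(G)` with respect to basepoint `w`. -/
def pointedHyp (G : SimpleGraph V) (w : V) : ℝ :=
  sInf {δ : ℝ | ∀ x y z : V, gp G x y w ≥ min (gp G x z w) (gp G y z w) - δ}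

/-- A walk is a geodesic (shortest path) if its length equals the distance. -/
def IsGeodesic (G : SimpleGraph V) {x y : V} (p : G.Walk x y) : Prop :=
  p.length = G.dist x y

/-- Thinness condition at corner `v` of a triangle, with sides `p : v → u` and `q : v → u'`. -/
def ThinCorner (G : SimpleGraph V) (δ : ℝ) {v u u' : V}
    (p : G.Walk v u) (q : G.Walk v u') : Prop :=
  ∀ a ∈ p.support, ∀ b ∈ q.support,
    G.dist v a = G.dist v b → (G.dist v a : ℝ) ≤ gp G u u' v →
    (G.dist a b : ℝ) ≤ δ

/-- A geodesic triangle with sides `p : x → y`, `q : y → z`, `r : z → x` is `δ`-thin. -/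
def TriangleThin (G : SimpleGraph V) (δ : ℝ) {x y z : V}
    (p : G.Walk x y) (q : G.Walk y z) (r : G.Walk z x) : Prop :=
  ThinCorner G δ p r.reverse ∧ ThinCorner G δ q p.reverse ∧ ThinCorner G δ r q.reverse

/-- Thinness `τ(G)`: least `δ` such that every geodesic triangle is `δ`-thin. -/
def thinness (G : SimpleGraph V) : ℝ :=
  sInf {δ : ℝ | ∀ (x y z : V) (p : G.Walk x y) (q : G.Walk y z) (r : G.Walk z x),
    IsGeodesic G p → IsGeodesic G q → IsGeodesic G r → TriangleThin G δ p q r}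

/-- The insize `max {d(y_z,z_y), d(z_x,x_z), d(x_y,y_x)}` of a geodesic triangle with
sides `p : x → y`, `q : y → z`, `r : z → x`. -/
def triInsize (G : SimpleGraph V) {x y z : V}
    (p : G.Walk x y) (q : G.Walk y z) (r : G.Walk z x) : ℝ :=
  max (G.dist (p.getVert ⌊gp G y z x⌋₊) (r.reverse.getVert ⌊gp G y z x⌋₊) : ℝ)
    (max (G.dist (q.getVert ⌊gp G z x y⌋₊) (p.reverse.getVert ⌊gp G z x y⌋₊) : ℝ)
      (G.dist (r.getVert ⌊gp G x y z⌋₊) (q.reverse.getVert ⌊gp G x y z⌋₊) : ℝ))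

/-- Insize `ι(G)`: least upper bound on insizes of geodesic triangles. -/
def insize (G : SimpleGraph V) : ℝ :=
  sInf {δ : ℝ | ∀ (x y z : V) (p : G.Walk x y) (q : G.Walk y z) (r : G.Walk z x),
    IsGeodesic G p → IsGeodesic G q → IsGeodesic G r → triInsize G p q r ≤ δ}

/-- A geodesic triangle with sides `p : x → y`, `q : y → z`, `r : z → x` is `δ`-slim. -/
def TriangleSlim (G : SimpleGraph V) (δ : ℝ) {x y z : V}
    (p : G.Walk x y) (q : G.Walk y z) (r : G.Walk z x) : Prop :=
  (∀ a ∈ p.support, ∃ b, (b ∈ q.support ∨ b ∈ r.support) ∧ (G.dist a b : ℝ) ≤ δ) ∧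
  (∀ a ∈ q.support, ∃ b, (b ∈ r.support ∨ b ∈ p.support) ∧ (G.dist a b : ℝ) ≤ δ) ∧
  (∀ a ∈ r.support, ∃ b, (b ∈ p.support ∨ b ∈ q.support) ∧ (G.dist a b : ℝ) ≤ δ)

/-- Slimness `ς(G)`: least `δ` such that every geodesic triangle is `δ`-slim. -/
def slimness (G : SimpleGraph V) : ℝ :=
  sInf {δ : ℝ | ∀ (x y z : V) (p : G.Walk x y) (q : G.Walk y z) (r : G.Walk z x),
    IsGeodesic G p → IsGeodesic G q → IsGeodesic G r → TriangleSlim G δ p q r}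

/-- The metric interval `I(u,v)`. -/
def interval (G : SimpleGraph V) (u v : V) : Set V :=
  {x | G.dist u x + G.dist x v = G.dist u v}

/-- Interval thinness `κ(G)`. -/
def intervalThinness (G : SimpleGraph V) : ℝ :=
  sInf {κ : ℝ | ∀ x y a b : V, a ∈ interval G x y → b ∈ interval G x y →
    G.dist x a = G.dist x b → (G.dist a b : ℝ) ≤ κ}

/-- A BFS-tree of `G` rooted at `w`: a spanning tree (encoded by its parent function)
in which the path from `w` to any vertex is a shortest path of `G`. -/
structure BFSTree (G : SimpleGraph V) (w : V) where
  parent : V → V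
  parent_root : parent w = w
  adj_parent : ∀ x, x ≠ w → G.Adj (parent x) x
  dist_parent : ∀ x, x ≠ w → G.dist w (parent x) + 1 = G.dist w x

/-- The vertex of the tree path `[w,x]_T` at distance `r` from the root `w`
(for `r ≤ d(w,x)`). -/
def treeVert (G : SimpleGraph V) {w : V} (T : BFSTree G w) (x : V) (r : ℕ) : V :=
  T.parent^[G.dist w x - r] x

/-- `v` lies on the tree path `[w,x]_T`. -/
def onRootPath (G : SimpleGraph V) {w : V} (T : BFSTree G w) (x v : V) : Prop :=
  ∃ i ≤ G.dist w x, v = T.parent^[i] x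

/-- The rooted insize `ρ_{w,T}(G) = max {d(x_y, y_x) : x, y ∈ V}`, where `x_y`, `y_x` are
the vertices of `[w,x]_T`, `[w,y]_T` at distance `⌊(x|y)_w⌋` from `w`. -/
def rootedInsize (G : SimpleGraph V) {w : V} (T : BFSTree G w) : ℝ :=
  sSup {ρ : ℝ | ∃ x y : V,
    ρ = (G.dist (treeVert G T x ⌊gp G x y w⌋₊) (treeVert G T y ⌊gp G x y w⌋₊) : ℝ)}

/-- The rooted thinness `μ_{w,T}(G)`. -/
def rootedThinness (G : SimpleGraph V) {w : V} (T : BFSTree G w) : ℝ :=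
  sSup {μ : ℝ | ∃ x y x' y' : V, onRootPath G T x x' ∧ onRootPath G T y y' ∧
    G.dist w x' = G.dist w y' ∧ (G.dist w x' : ℝ) ≤ gp G x y w ∧
    μ = (G.dist x' y' : ℝ)}


variable {G : SimpleGraph V} {w : V}

theorem dist_iterate_parent_le (hG : G.Connected) (T : BFSTree G w) (n : ℕ) (x : V) :
    G.dist (T.parent^[n] x) x ≤ n := by
  induction n with
  | zero => simp
  | succ n ih =>
    have hp : ∀ u, G.dist (T.parent u) u ≤ 1 := fun u => by
      by_cases hu : u = w
      · simp [hu, T.parent_root]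
      · exact (dist_eq_one_iff_adj.mpr (T.adj_parent u hu)).le
    rw [Function.iterate_succ_apply']
    have := hG.dist_triangle (u := T.parent (T.parent^[n] x)) (v := T.parent^[n] x) (w := x)
    have := hp (T.parent^[n] x)
    omega

theorem dist_treeVert_self_le (hG : G.Connected) (T : BFSTree G w) (x : V) (r : ℕ) :
    G.dist (treeVert G T x r) x ≤ G.dist w x - r :=
  dist_iterate_parent_le hG T _ x

theorem dist_treeVert_treeVert_le (hG : G.Connected) (T : BFSTree G w) (x : V) {r s : ℕ}
    (hrs : r ≤ s) (hs : s ≤ G.dist w x) :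
    G.dist (treeVert G T x r) (treeVert G T x s) ≤ s - r := by
  have : treeVert G T x r = T.parent^[s - r] (treeVert G T x s) := by
    rw [treeVert, treeVert, ← Function.iterate_add_apply]
    congr 2
    omega
  rw [this]
  exact dist_iterate_parent_le hG T _ _

theorem dist_treeVert_le_rootedInsize [Finite V] (T : BFSTree G w) (x y : V) :
    (G.dist (treeVert G T x ⌊gp G x y w⌋₊) (treeVert G T y ⌊gp G x y w⌋₊) : ℝ) ≤
      rootedInsize G T := by
  refine le_csSup (Set.Finite.bddAbove ?_) ⟨x, y, rfl⟩
  refine (Set.finite_range fun p : V × V =>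
    (G.dist (treeVert G T p.1 ⌊gp G p.1 p.2 w⌋₊)
      (treeVert G T p.2 ⌊gp G p.1 p.2 w⌋₊) : ℝ)).subset ?_
  rintro _ ⟨x, y, rfl⟩
  exact ⟨(x, y), rfl⟩

theorem gp_comm (x y w : V) : gp G x y w = gp G y x w := by
  simp only [gp, G.dist_comm (u := x) (v := y)]
  ring

theorem floor_gp_le_dist (hG : G.Connected) (x y w : V) : ⌊gp G x y w⌋₊ ≤ G.dist w x := by
  refine Nat.floor_le_of_le ?_
  have : (G.dist y w : ℝ) ≤ G.dist y x + G.dist x w := by exact_mod_cast hG.dist_triangle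
  rw [G.dist_comm (u := y) (v := x)] at this
  rw [gp, G.dist_comm (u := w)]
  linarith

theorem gp_le_floor_add_half (x y w : V) :
    gp G x y w ≤ ⌊gp G x y w⌋₊ + 1 / 2 := by
  have h := Nat.lt_floor_add_one (gp G x y w)
  set k := ⌊gp G x y w⌋₊
  have h' : G.dist x w + G.dist y w < 2 * (k + 1) + G.dist x y := by
    have : (G.dist x w : ℝ) + G.dist y w < 2 * (k + 1) + G.dist x y := by
      rw [gp] at h
      linarith
    exact_mod_cast this
  have h'' : (G.dist x w : ℝ) + G.dist y w ≤ 2 * k + 1 + G.dist x y := by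
    exact_mod_cast (by omega : G.dist x w + G.dist y w ≤ 2 * k + 1 + G.dist x y)
  rw [gp]
  linarith

/-- With `ρ = ρ_{w,T}(G)`: for vertices `x, y, z` with `z ∈ I(x,y)`, if `d(y,z) ≤ (w|x)_y`
then `(w|y)_z = (w|x)_z − (w|x)_y + d(y,z)` and `(w|y)_z ≤ ρ + 1/2`. -/
theorem gp_le_rootedInsize_add_half
    {V : Type*} [Fintype V] (G : SimpleGraph V) (hG : G.Connected)
    (w : V) (T : BFSTree G w) (x y z : V)
    (hz : z ∈ interval G x y) (h : (G.dist y z : ℝ) ≤ gp G w x y) :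
    gp G w y z = gp G w x z - gp G w x y + (G.dist y z : ℝ) ∧
      gp G w y z ≤ rootedInsize G T + 1 / 2 := by
  have hz' : (G.dist x z : ℝ) + G.dist z y = G.dist x y := by exact_mod_cast hz
  have hxz := dist_treeVert_le_rootedInsize T x z
  have hzy := dist_treeVert_le_rootedInsize T z y
  have hab : ⌊gp G x z w⌋₊ ≤ ⌊gp G z y w⌋₊ := by
    refine Nat.floor_le_floor ?_
    simp only [gp, G.dist_comm (u := y) (v := z), G.dist_comm (u := w)] at h ⊢
    linarith
  have hfloor := gp_le_floor_add_half (G := G) x z w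
  have hax := floor_gp_le_dist hG x z w
  have hbz := floor_gp_le_dist hG z y w
  have hby := gp_comm (G := G) z y w ▸ floor_gp_le_dist hG y z w
  set a := ⌊gp G x z w⌋₊
  set b := ⌊gp G z y w⌋₊
  have hpath : G.dist x y + 2 * a ≤ G.dist w x + G.dist w y +
      G.dist (treeVert G T x a) (treeVert G T z a) +
      G.dist (treeVert G T z b) (treeVert G T y b) := by
    have h₁ := dist_treeVert_self_le hG T x a
    have h₂ := dist_treeVert_treeVert_le hG T z hab hbz
    have h₃ := dist_treeVert_self_le hG T y b
    have t₁ := hG.dist_triangle (u := x) (v := treeVert G T x a) (w := y)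
    have t₂ := hG.dist_triangle (u := treeVert G T x a) (v := treeVert G T z a) (w := y)
    have t₃ := hG.dist_triangle (u := treeVert G T z a) (v := treeVert G T z b) (w := y)
    have t₄ := hG.dist_triangle (u := treeVert G T z b) (v := treeVert G T y b) (w := y)
    rw [G.dist_comm (u := x) (v := treeVert G T x a)] at t₁
    omega
  have hpath' : (G.dist x y : ℝ) + 2 * a ≤ G.dist w x + G.dist w y +
      G.dist (treeVert G T x a) (treeVert G T z a) +
      G.dist (treeVert G T z b) (treeVert G T y b) := by exact_mod_cast hpath
  simp only [gp, G.dist_comm (u := y) (v := z), G.dist_comm (u := w)] at h hfloor hpath' ⊢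
  constructor <;> linarith

end HypPaper
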